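/- Consider ℝ with its standard topology and the continuous map S : ℝ → ℝ, S(x) = 2x. Then: (1) if U ⊆ ℝ is open, 0 ∈ U, and S[U] ⊆ U, then U = ℝ; consequently, for any dynamic topological model M based on (ℝ,S) and any formula φ, 0 ∈ ⟦□φ⟧ if and only if ⟦φ⟧ = ℝ. (2) If 0 < a < x and (a,∞) ⊆ ⟦φ⟧, then x ∈ ⟦□φ⟧; similarly, if x < a < 0 and (−∞,a) ⊆ ⟦φ⟧, then x ∈ ⟦□φ⟧. -/

import Mathlib

/-- Formulas of the language `L` of intuitionistic linear temporal logic. -/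
inductive Formula : Type
  | bot : Formula
  | var : ℕ → Formula
  | and : Formula → Formula → Formula
  | or : Formula → Formula → Formula
  | impl : Formula → Formula → Formula
  | next : Formula → Formula
  | diam : Formula → Formula
  | box : Formula → Formula
deriving DecidableEq

namespace Formula

/-- `¬φ` abbreviates `φ → ⊥`. -/
def neg (φ : Formula) : Formula := impl φ bot

/-- `φ ↔ ψ` abbreviates `(φ → ψ) ∧ (ψ → φ)`. -/
def iff (φ ψ : Formula) : Formula := and (impl φ ψ) (impl ψ φ)

end Formula

/-- Derivability in `ITL⁰` extended with an additional set of axioms `Ax`.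
The intuitionistic propositional tautologies are generated by a standard
complete Hilbert-style axiomatization of intuitionistic propositional logic
(closed under modus ponens). -/
inductive ITL (Ax : Formula → Prop) : Formula → Prop
  | extra {φ} : Ax φ → ITL Ax φ
  -- (i) intuitionistic propositional axioms
  | then1 (φ ψ : Formula) : ITL Ax (.impl φ (.impl ψ φ))
  | then2 (φ ψ χ : Formula) :
      ITL Ax (.impl (.impl φ (.impl ψ χ)) (.impl (.impl φ ψ) (.impl φ χ)))
  | andE1 (φ ψ : Formula) : ITL Ax (.impl (.and φ ψ) φ)
  | andE2 (φ ψ : Formula) : ITL Ax (.impl (.and φ ψ) ψ)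
  | andI (φ ψ : Formula) : ITL Ax (.impl φ (.impl ψ (.and φ ψ)))
  | orI1 (φ ψ : Formula) : ITL Ax (.impl φ (.or φ ψ))
  | orI2 (φ ψ : Formula) : ITL Ax (.impl ψ (.or φ ψ))
  | orE (φ ψ χ : Formula) :
      ITL Ax (.impl (.impl φ χ) (.impl (.impl ψ χ) (.impl (.or φ ψ) χ)))
  | botE (φ : Formula) : ITL Ax (.impl .bot φ)
  -- (ii)–(x) temporal axioms
  | nextBot : ITL Ax (.neg (.next .bot))
  | nextAnd (φ ψ : Formula) :
      ITL Ax (.iff (.next (.and φ ψ)) (.and (.next φ) (.next ψ)))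
  | nextOr (φ ψ : Formula) :
      ITL Ax (.iff (.next (.or φ ψ)) (.or (.next φ) (.next ψ)))
  | nextK (φ ψ : Formula) :
      ITL Ax (.impl (.next (.impl φ ψ)) (.impl (.next φ) (.next ψ)))
  | boxK (φ ψ : Formula) :
      ITL Ax (.impl (.box (.impl φ ψ)) (.impl (.box φ) (.box ψ)))
  | diamK (φ ψ : Formula) :
      ITL Ax (.impl (.box (.impl φ ψ)) (.impl (.diam φ) (.diam ψ)))
  | diamOr (φ ψ : Formula) :
      ITL Ax (.impl (.diam (.or φ ψ)) (.or (.diam φ) (.diam ψ)))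
  | boxFix (φ : Formula) : ITL Ax (.impl (.box φ) (.and φ (.next (.box φ))))
  | diamFix (φ : Formula) : ITL Ax (.impl (.or φ (.next (.diam φ))) (.diam φ))
  -- rules (xi)–(xiv)
  | ind1 {φ : Formula} : ITL Ax (.impl φ (.next φ)) → ITL Ax (.impl φ (.box φ))
  | ind2 {φ : Formula} : ITL Ax (.impl (.next φ) φ) → ITL Ax (.impl (.diam φ) φ)
  | mp {φ ψ : Formula} : ITL Ax (.impl φ ψ) → ITL Ax φ → ITL Ax ψ
  | nec {φ : Formula} : ITL Ax φ → ITL Ax (.next φ)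

/-- The Fischer Servi axiom schemes FS◦ and FS◇. -/
def FSAx : Formula → Prop := fun χ => ∃ φ ψ : Formula,
  χ = .impl (.impl (.next φ) (.next ψ)) (.next (.impl φ ψ)) ∨
  χ = .impl (.impl (.diam φ) (.box ψ)) (.box (.impl φ ψ))

/-- The constant domain axiom scheme CD. -/
def CDAx : Formula → Prop := fun χ => ∃ φ ψ : Formula,
  χ = .impl (.box (.or φ ψ)) (.or (.box φ) (.diam ψ))

/-- The logic ITL⁰. -/
def ITL0 : Formula → Prop := ITL (fun _ => False)

/-- The logic ITL^FS = ITL⁰ + FS◦ + FS◇. -/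
def ITLFS : Formula → Prop := ITL FSAx

/-- The logic ITL^CD = ITL⁰ + CD. -/
def ITLCD : Formula → Prop := ITL CDAx

/-- The logic ITL¹ = ITL^FS + ITL^CD. -/
def ITL1 : Formula → Prop := ITL (fun χ => FSAx χ ∨ CDAx χ)

/-- A valuation on a dynamical topological system `(X, T, S)`: a map from
formulas to open sets satisfying the semantic clauses. -/
structure DTValuation (X : Type) (T : TopologicalSpace X) (S : X → X) where
  val : Formula → Set X
  isOpen_val : ∀ φ, @IsOpen X T (val φ)
  val_bot : val .bot = ∅
  val_and : ∀ φ ψ, val (.and φ ψ) = val φ ∩ val ψ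
  val_or : ∀ φ ψ, val (.or φ ψ) = val φ ∪ val ψ
  val_impl : ∀ φ ψ, val (.impl φ ψ) = @interior X T ((val φ)ᶜ ∪ val ψ)
  val_next : ∀ φ, val (.next φ) = S ⁻¹' val φ
  val_diam : ∀ φ, val (.diam φ) = ⋃ n : ℕ, (S^[n]) ⁻¹' val φ
  val_box : ∀ φ, val (.box φ) =
    ⋃₀ {U : Set X | @IsOpen X T U ∧ S '' U ⊆ U ∧ U ⊆ val φ}

/-- The up-set topology of a preorder: the open sets are the upward closed sets. -/
def upsetTopology (X : Type) [Preorder X] : TopologicalSpace X where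
  IsOpen U := IsUpperSet U
  isOpen_univ := isUpperSet_univ
  isOpen_inter := fun _ _ hU hV => hU.inter hV
  isOpen_sUnion := fun _ hs => isUpperSet_sUnion hs

/-- An open neighbourhood of `0` in `ℝ` that is closed under doubling is all of `ℝ`. -/
theorem eq_univ_of_isOpen_of_image_two_mul_subset {U : Set ℝ} (hU : IsOpen U)
    (h0 : (0 : ℝ) ∈ U) (hS : (fun x : ℝ => 2 * x) '' U ⊆ U) : U = Set.univ := by
  refine Set.eq_univ_of_forall fun x => ?_
  have hlim : Filter.Tendsto (fun n : ℕ => (1 / 2 : ℝ) ^ n * x) Filter.atTop (nhds 0) := by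
    simpa using (tendsto_pow_atTop_nhds_zero_of_lt_one (r := (1 / 2 : ℝ))
      (by norm_num) (by norm_num)).mul_const x
  obtain ⟨n, hn⟩ := (hlim.eventually (hU.mem_nhds h0)).exists
  have hmaps : Set.MapsTo (fun x : ℝ => 2 * x) U U := Set.mapsTo_iff_image_subset.mpr hS
  have hx := hmaps.iterate n hn
  rw [mul_left_iterate] at hx
  beta_reduce at hx
  rwa [← mul_assoc, ← mul_pow, mul_one_div_cancel two_ne_zero, one_pow,
    one_mul] at hx

/-- Example 1: the `henceforth` modality on `(ℝ, S)` with `S x = 2x`. -/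
theorem box_on_R :
    (∀ U : Set ℝ, IsOpen U → (0 : ℝ) ∈ U → (fun x : ℝ => 2 * x) '' U ⊆ U →
      U = Set.univ) ∧
    (∀ V : DTValuation ℝ inferInstance (fun x : ℝ => 2 * x), ∀ φ : Formula,
      ((0 : ℝ) ∈ V.val (.box φ) ↔ V.val φ = Set.univ) ∧
      (∀ a x : ℝ, 0 < a → a < x → Set.Ioi a ⊆ V.val φ → x ∈ V.val (.box φ)) ∧
      (∀ a x : ℝ, x < a → a < 0 → Set.Iio a ⊆ V.val φ → x ∈ V.val (.box φ))) := by
  refine ⟨fun U hU h0 hS => eq_univ_of_isOpen_of_image_two_mul_subset hU h0 hS,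
    fun V φ => ⟨⟨?_, ?_⟩, ?_, ?_⟩⟩
  · rw [V.val_box]
    rintro ⟨U, ⟨hU, hS, hUφ⟩, h0⟩
    rw [eq_univ_of_isOpen_of_image_two_mul_subset hU h0 hS] at hUφ
    exact Set.univ_subset_iff.mp hUφ
  · intro h
    rw [V.val_box]
    exact ⟨Set.univ, ⟨isOpen_univ, Set.subset_univ _, h.ge⟩, Set.mem_univ _⟩
  · intro a x ha hx h
    rw [V.val_box]
    refine ⟨Set.Ioi a, ⟨isOpen_Ioi, ?_, h⟩, hx⟩
    rintro _ ⟨y, hy, rfl⟩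
    simp only [Set.mem_Ioi] at hy ⊢
    linarith
  · intro a x hx ha h
    rw [V.val_box]
    refine ⟨Set.Iio a, ⟨isOpen_Iio, ?_, h⟩, hx⟩
    rintro _ ⟨y, hy, rfl⟩
    simp only [Set.mem_Iio] at hy ⊢
    linarith
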